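/- Let p be an odd prime and G a finite subgroup of GL_2(F_p) acting irreducibly on V = F_p^2. Then H^i(G, V) = 0 for all i ≥ 0. -/

import Mathlib

open Matrix

/-- The representation of a subgroup `G ≤ GL₂(𝔽_p)` on the standard module `𝔽_p²`. -/
def stdRep (p : ℕ) [Fact p.Prime] (G : Subgroup (GL (Fin 2) (ZMod p))) :
    Representation (ZMod p) G (Fin 2 → ZMod p) where
  toFun g := Matrix.mulVecLin ((g : GL (Fin 2) (ZMod p)) : Matrix (Fin 2) (Fin 2) (ZMod p))
  map_one' := by
    ext v i
    simp
  map_mul' g h := by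
    ext v i
    simp [Matrix.mulVecLin_mul]

section Aux

open CategoryTheory

/-- The central element acts as an endomorphism of every representation. -/
noncomputable def centralEnd {k G : Type} [Field k] [Group G] (z : G) (hz : ∀ g, z * g = g * z)
    (A : Rep.{0} k G) : A ⟶ A :=
  Rep.ofHom ⟨A.ρ z, fun g => by
    rw [← Module.End.mul_eq_comp, ← Module.End.mul_eq_comp, ← map_mul, ← map_mul, hz]⟩

lemma centralEnd_comm {k G : Type} [Field k] [Group G] (z : G) (hz : ∀ g, z * g = g * z)
    {A B : Rep.{0} k G} (f : A ⟶ B) :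
    centralEnd z hz A ≫ f = f ≫ centralEnd z hz B := by
  ext x
  exact Rep.hom_comm_apply f z x

lemma isZero_of_central {k G : Type} [Field k] (h2 : (2 : k) ≠ 0) [Group G] (z : G)
    (hz : ∀ g, z * g = g * z)
    (A : Rep.{0} k G) (hA : ∀ v : A, A.ρ z v = -v) (n : ℕ) :
    Subsingleton (groupCohomology A n) := by
  let T := Rep.trivial k G k
  let P : ProjectiveResolution T := Rep.barResolution k G
  let F := ((linearYoneda k (Rep.{0} k G)).obj A).rightOp
  let g : P.complex ⟶ P.complex :=
    { f := fun i => centralEnd z hz (P.complex.X i)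
      comm' := fun i j _ => centralEnd_comm z hz _ }
  have hT : centralEnd z hz T = 𝟙 T := by
    ext
    simp [centralEnd, T]
  have hzA : centralEnd z hz A = -𝟙 A := by
    ext x
    exact hA x
  have w : g ≫ P.π = P.π ≫ (ChainComplex.single₀ _).map (𝟙 T) := by
    rw [CategoryTheory.Functor.map_id, Category.comp_id]
    ext1
    have h := centralEnd_comm z hz (P.π.f 0)
    have h' : centralEnd z hz (((ChainComplex.single₀ (Rep k G)).obj T).X 0) = 𝟙 _ := hT
    rw [h', Category.comp_id] at h
    exact h
  have key := F.leftDerived_map_eq n (𝟙 T) g w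
  have hneg : (F.mapHomologicalComplex (ComplexShape.down ℕ)).map g = -𝟙 _ := by
    ext1 i
    change (((linearYoneda k (Rep.{0} k G)).obj A).map (centralEnd z hz (P.complex.X i)).op).op = -𝟙 _
    have : ((linearYoneda k (Rep.{0} k G)).obj A).map (centralEnd z hz (P.complex.X i)).op = -𝟙 _ := by
      ext f
      have hf : ∀ f : P.complex.X i ⟶ A, centralEnd z hz (P.complex.X i) ≫ f = -f := by
        intro f
        rw [centralEnd_comm, hzA, Preadditive.comp_neg, Category.comp_id]
      exact hf f
    rw [this]
    rfl
  rw [Functor.comp_map, hneg, Functor.map_neg, CategoryTheory.Functor.map_id, CategoryTheory.Functor.map_id,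
    Preadditive.neg_comp, Category.id_comp, Preadditive.comp_neg, Iso.hom_inv_id] at key
  have key2 : 𝟙 (groupCohomology A n) = -𝟙 (groupCohomology A n) := by
    have e := groupCohomologyIsoExt A n
    have hX : 𝟙 (((Ext k (Rep k G) n).obj (Opposite.op T)).obj A) = - 𝟙 _ :=
      congrArg Quiver.Hom.unop key
    have h5 : 𝟙 (groupCohomology A n) = e.hom ≫ 𝟙 _ ≫ e.inv := by simp
    have h6 : e.hom ≫ 𝟙 _ ≫ e.inv = e.hom ≫ (-𝟙 _) ≫ e.inv :=
      congrArg (fun x => e.hom ≫ x ≫ e.inv) hX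
    refine (h5.trans h6).trans ?_
    simp
  refine ⟨fun a b => ?_⟩
  have hh : ∀ a : groupCohomology A n, a = 0 := by
    intro a
    have := congrArg (fun f => f.hom a) key2
    have h3 : a = -a := this
    have h4 : (2 : k) • a = 0 := by
      rw [two_smul]; nth_rewrite 1 [h3]; simp
    exact (smul_eq_zero.mp h4).resolve_left h2
  rw [hh a, hh b]

lemma isZero_of_invertible {k G : Type} [Field k] [Group G] [Finite G]
    [NeZero (Nat.card G : k)] (A : Rep.{0} k G) (n : ℕ) :
    Subsingleton (groupCohomology A (n + 1)) := by
  have : Limits.IsZero (groupCohomology A (n + 1)) :=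
    (isZero_Ext_succ_of_projective (Rep.trivial k G k) A n).of_iso <| groupCohomologyIsoExt _ _
  exact ModuleCat.subsingleton_of_isZero this

lemma nilp_facts {k : Type*} [Field k] (N : Matrix (Fin 2) (Fin 2) k) (h : IsNilpotent N) :
    N 1 1 = - N 0 0 ∧ N 0 0 * N 0 0 + N 0 1 * N 1 0 = 0 := by
  have ht : N.trace = 0 := (Matrix.isNilpotent_trace_of_isNilpotent h).eq_zero
  have hd : N.det = 0 := by
    obtain ⟨n, hn⟩ := h
    have : N.det ^ n = 0 := by
      rw [← Matrix.det_pow, hn]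
      rcases n with _ | n
      · exact absurd hn (by simp)
      · simp
    exact pow_eq_zero_iff (n := n) (by rintro rfl; simp at this) |>.mp this
  rw [Matrix.trace_fin_two] at ht
  rw [Matrix.det_fin_two] at hd
  have h1 : N 1 1 = - N 0 0 := by linear_combination ht
  refine ⟨h1, ?_⟩
  rw [h1] at hd
  linear_combination -hd

lemma neg_one_mem (p : ℕ) [Fact p.Prime]
    (G : Subgroup (GL (Fin 2) (ZMod p)))
    (hirr : ∀ W : Submodule (ZMod p) (Fin 2 → ZMod p),
      (∀ g ∈ G, ∀ v ∈ W, (g : Matrix (Fin 2) (Fin 2) (ZMod p)).mulVec v ∈ W) →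
      W = ⊥ ∨ W = ⊤) (hp : p ∣ Nat.card G) : (-1 : GL (Fin 2) (ZMod p)) ∈ G := by
  obtain ⟨u, hu⟩ := exists_prime_orderOf_dvd_card' p hp
  set U : Matrix (Fin 2) (Fin 2) (ZMod p) := ((u : GL (Fin 2) (ZMod p)) : Matrix (Fin 2) (Fin 2) (ZMod p)) with hU
  have hUp : U ^ p = 1 := by
    have h1 : u ^ p = 1 := orderOf_dvd_iff_pow_eq_one.mp hu.dvd
    have h2 : ((u ^ p : G) : GL (Fin 2) (ZMod p)) = 1 := by rw [h1]; rfl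
    have := congrArg (fun x : GL (Fin 2) (ZMod p) => (x : Matrix (Fin 2) (Fin 2) (ZMod p))) h2
    simpa using this
  set N := U - 1 with hN
  have hUN : U = 1 + N := by rw [hN]; abel
  have hN0 : N ≠ 0 := by
    intro h
    have h1 : U = 1 := by rw [hUN, h, add_zero]
    have h2 : u = 1 := by
      apply Subtype.ext; apply Units.ext; exact h1
    rw [h2, orderOf_one] at hu
    exact (Fact.out : p.Prime).one_lt.ne hu
  have hnil : IsNilpotent N := ⟨p, by
    rw [hN, sub_pow_char_of_commute (p := p) (Commute.one_right U), hUp]; simp⟩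
  -- find `g` with `N (g v) ≠ 0`, `N v = 0`
  obtain ⟨hN1, hN2⟩ := nilp_facts N hnil
  have hNN : N * N = 0 := by
    ext i j
    fin_cases i <;> fin_cases j <;> simp [Matrix.mul_apply, Fin.sum_univ_two, hN1] <;>
      first | linear_combination hN2 | ring
  obtain ⟨g, hg, v, hv, hgv⟩ : ∃ g ∈ G, ∃ v, N.mulVec v = 0 ∧
      N.mulVec ((g : Matrix (Fin 2) (Fin 2) (ZMod p)).mulVec v) ≠ 0 := by
    by_contra hcon
    push Not at hcon
    rcases hirr (LinearMap.ker N.mulVecLin) (fun g hg v hv => hcon g hg v hv) with h | h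
    · apply hN0
      have hinj := LinearMap.ker_eq_bot.mp h
      apply Matrix.toLin'.injective
      refine LinearMap.ext fun x => ?_
      apply hinj
      change N.mulVec (N.mulVec x) = N.mulVec ((Matrix.toLin' 0) x)
      rw [Matrix.mulVec_mulVec, hNN]
      simp
    · apply hN0
      apply Matrix.toLin'.injective
      rw [LinearMap.ker_eq_top] at h
      rw [map_zero]
      exact h
  set f := (g : Matrix (Fin 2) (Fin 2) (ZMod p)).mulVec v with hf
  set g' : Matrix (Fin 2) (Fin 2) (ZMod p) := ((g⁻¹ : GL (Fin 2) (ZMod p)) : Matrix (Fin 2) (Fin 2) (ZMod p)) with hg'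
  set γ : Matrix (Fin 2) (Fin 2) (ZMod p) := (g : Matrix (Fin 2) (Fin 2) (ZMod p)) with hγ
  have hgg : g' * γ = 1 := Units.inv_mul g
  have hgg' : γ * g' = 1 := Units.mul_inv g
  set M := γ * N * g' with hM
  have hMf : M.mulVec f = 0 := by
    rw [hf, hM, Matrix.mulVec_mulVec, mul_assoc, hgg, mul_one, ← Matrix.mulVec_mulVec, hv,
      Matrix.mulVec_zero]
  have hMM : M * M = 0 := by
    have : M * M = γ * N * (g' * γ) * N * g' := by simp only [hM, mul_assoc]
    rw [this, hgg, mul_one, mul_assoc γ, hNN]; simp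
  have hM0 : M ≠ 0 := by
    intro h
    apply hN0
    have : N = g' * M * γ := by
      have : g' * M * γ = (g' * γ) * N * (g' * γ) := by simp only [hM, mul_assoc]
      rw [this, hgg]; simp
    rw [this, h]; simp
  obtain ⟨hM1, hM2⟩ := nilp_facts M ⟨2, by rw [pow_two, hMM]⟩
  obtain ⟨c, hc⟩ : ∃ c : ZMod p, N * M + M * N = c • (1 : Matrix (Fin 2) (Fin 2) (ZMod p)) := by
    refine ⟨2 * (N 0 0 * M 0 0) + N 0 1 * M 1 0 + N 1 0 * M 0 1, ?_⟩
    ext i j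
    fin_cases i <;> fin_cases j <;> simp [Matrix.mul_apply, Fin.sum_univ_two, hN1, hM1] <;> ring
  have hc0 : c ≠ 0 := by
    rintro rfl
    have h1 : M.mulVec (N.mulVec f) = 0 := by
      have := congrArg (fun X => X.mulVec f) hc
      simpa [Matrix.add_mulVec, ← Matrix.mulVec_mulVec, hMf] using this
    have hNNf : N.mulVec (N.mulVec f) = 0 := by rw [Matrix.mulVec_mulVec, hNN, Matrix.zero_mulVec]
    set e := N.mulVec f with he
    -- D = det [f,e]
    have hD : f 0 * e 1 - f 1 * e 0 = 0 := by
      by_contra hD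
      apply hM0
      have a0 := congrFun h1 0
      have a1 := congrFun h1 1
      have b0 := congrFun hMf 0
      have b1 := congrFun hMf 1
      simp only [Matrix.mulVec, dotProduct, Fin.sum_univ_two, Pi.zero_apply] at a0 a1 b0 b1
      ext i j
      apply mul_left_cancel₀ hD
      rw [Matrix.zero_apply, mul_zero]
      fin_cases i <;> fin_cases j
      · dsimp; linear_combination e 1 * b0 - f 1 * a0
      · dsimp; linear_combination f 0 * a0 - e 0 * b0
      · dsimp; linear_combination e 1 * b1 - f 1 * a1
      · dsimp; linear_combination f 0 * a1 - e 0 * b1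
    have n0 := congrFun hNNf 0
    have n1 := congrFun hNNf 1
    have q0 := congrFun he 0
    have q1 := congrFun he 1
    simp only [Matrix.mulVec, dotProduct, Fin.sum_univ_two, Pi.zero_apply] at n0 n1 q0 q1
    have z0 : e 0 * e 0 = 0 := by
      linear_combination e 0 * q0 + f 0 * n0 - N 0 1 * hD
    have z1 : e 1 * e 1 = 0 := by
      linear_combination e 1 * q1 + f 1 * n1 + N 1 0 * hD
    apply hgv
    ext i
    fin_cases i
    · simpa using z0
    · simpa using z1
  obtain ⟨k, hk⟩ : ∃ k : ℕ, (k : ZMod p) * c = -1 :=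
    ⟨(-c⁻¹ : ZMod p).val, by rw [ZMod.natCast_zmod_val]; field_simp⟩
  have hpow : ∀ k : ℕ, U ^ k = 1 + (k : ZMod p) • N := by
    intro k
    induction k with
    | zero => simp
    | succ k ih =>
      rw [pow_succ, ih, hUN]
      simp only [add_mul, mul_add, one_mul, mul_one, smul_mul_assoc, hNN, smul_zero, add_zero]
      push_cast
      rw [add_smul, one_smul]; abel
  set N' := (k : ZMod p) • N with hN'
  have hN'N' : N' * N' = 0 := by simp [hN', hNN]
  have hanti : N' * M + M * N' = -1 := by
    have : N' * M + M * N' = (k : ZMod p) • (N * M + M * N) := by simp [hN']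
    rw [this, hc, smul_smul, hk]; simp
  have hW : (1 + N') * (1 + M) * (1 + N') = N' + M := by
    have h1 : M * N' = -1 - N' * M := by rw [← hanti]; abel
    have h2 : N' * M * N' = - N' := by
      rw [mul_assoc, h1, mul_sub, ← mul_assoc, hN'N']; simp
    have : (1 + N') * (1 + M) * (1 + N') =
      1 + N' + M + (N' * M + M * N') + N' + N' * N' + N' * M * N' := by noncomm_ring
    rw [this, h2, hanti, hN'N']; abel
  have hW2 : (N' + M) * (N' + M) = -1 := by
    have : (N' + M) * (N' + M) = N' * N' + M * M + (N' * M + M * N') := by noncomm_ring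
    rw [this, hanti, hN'N', hMM]; simp
  set w : GL (Fin 2) (ZMod p) := (u : GL (Fin 2) (ZMod p)) ^ k * (g * u * g⁻¹) *
    (u : GL (Fin 2) (ZMod p)) ^ k with hw
  have hwG : w ∈ G :=
    G.mul_mem (G.mul_mem (G.pow_mem u.2 k) (G.mul_mem (G.mul_mem hg u.2) (G.inv_mem hg)))
      (G.pow_mem u.2 k)
  have hwm : (w : Matrix (Fin 2) (Fin 2) (ZMod p)) = N' + M := by
    rw [← hW, ← hpow k]
    have : 1 + M = γ * U * g' := by
      rw [hUN, mul_add, add_mul, mul_one, hgg']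
    rw [this, hw]
    simp only [Units.val_mul, Units.val_pow_eq_pow_val]
    rfl
  have : (-1 : GL (Fin 2) (ZMod p)) = w * w := by
    apply Units.ext
    rw [Units.val_mul, hwm, hW2]; rfl
  rw [this]
  exact G.mul_mem hwG hwG

end Aux

/-- If `p` is an odd prime and `G` is a (finite) subgroup of `GL₂(𝔽_p)` acting irreducibly on
the standard representation `V = 𝔽_p²`, then `Hⁱ(G, V) = 0` for all `i ≥ 0`. -/
theorem cohomology_vanishes_of_irreducible (p : ℕ) [Fact p.Prime] (hodd : Odd p)
    (G : Subgroup (GL (Fin 2) (ZMod p)))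
    (hirr : ∀ W : Submodule (ZMod p) (Fin 2 → ZMod p),
      (∀ g ∈ G, ∀ v ∈ W, (g : Matrix (Fin 2) (Fin 2) (ZMod p)).mulVec v ∈ W) →
      W = ⊥ ∨ W = ⊤)
    (i : ℕ) :
    Subsingleton (groupCohomology (Rep.of (stdRep p G)) i) := by
  have hGfin : Finite G := inferInstance
  by_cases hp : p ∣ Nat.card G
  · have hneg := neg_one_mem p G hirr hp
    have h2 : (2 : ZMod p) ≠ 0 := by
      have hp2 : Fact (2 < p) := ⟨by
        have := (Fact.out : p.Prime).two_le
        rcases hodd with ⟨m, hm⟩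
        omega⟩
      intro h
      have h3 : ((2 : ℕ) : ZMod p) = 0 := by exact_mod_cast h
      rw [ZMod.natCast_eq_zero_iff] at h3
      exact absurd (Nat.le_of_dvd (by norm_num) h3) (not_le.mpr hp2.out)
    refine isZero_of_central h2 (⟨-1, hneg⟩ : G) (fun g => ?_) _ (fun v => ?_) i
    · apply Subtype.ext
      simp
    · change (((-1 : GL (Fin 2) (ZMod p)) : Matrix (Fin 2) (Fin 2) (ZMod p))).mulVec v = -v
      rw [Units.val_neg, Units.val_one, Matrix.neg_mulVec, Matrix.one_mulVec]
  · have : NeZero (Nat.card G : ZMod p) := ⟨fun h => hp ((ZMod.natCast_eq_zero_iff _ _).mp h)⟩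
    rcases i with _ | i
    · have hinv : (stdRep p G).invariants = ⊥ := by
        rcases hirr (stdRep p G).invariants (fun g hg v hv => by
          have h1 : (g : Matrix (Fin 2) (Fin 2) (ZMod p)).mulVec v = v := hv ⟨g, hg⟩
          rw [h1]; exact hv) with h | h
        · exact h
        · exfalso
          have hall : ∀ g ∈ G, ∀ v, (g : Matrix (Fin 2) (Fin 2) (ZMod p)).mulVec v = v := by
            intro g hg v
            have hv : v ∈ (stdRep p G).invariants := by rw [h]; trivial
            exact hv ⟨g, hg⟩
          have hline := hirr (Submodule.span (ZMod p) {![1, 0]}) (fun g hg v hv => by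
            rw [hall g hg v]; exact hv)
          rcases hline with h | h
          · rw [Submodule.span_singleton_eq_bot] at h
            simpa using congrFun h 0
          · have h1 : (![0, 1] : Fin 2 → ZMod p) ∈ Submodule.span (ZMod p) {![1, 0]} := by
              rw [h]; trivial
            obtain ⟨a, ha⟩ := Submodule.mem_span_singleton.mp h1
            simpa using congrFun ha 1
      have e := (groupCohomology.H0Iso (Rep.of (stdRep p G))).toLinearEquiv
      have hs : Subsingleton (stdRep p G).invariants := by rw [hinv]; infer_instance
      have hs' : Subsingleton (ModuleCat.of (ZMod p) (Rep.of (stdRep p G)).ρ.invariants) := hs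
      exact e.toEquiv.subsingleton
    · exact isZero_of_invertible _ i
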